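/- Suppose G : Ω × Ω → ℝ satisfies |G(x,y)| ≤ C(1 + |log|x-y||) for all x ≠ y in a bounded set Ω ⊂ ℝ⁴ of diameter d. Then there is a constant C' (depending on C, d, |Ω|) such that for all x ∈ Ω and all p ≥ 1, ∫_Ω |G(x,y)|^{p+1} dy ≤ C'^{p+1} (p+1)^{p+2}. -/

import Mathlib

open MeasureTheory

local notation "E" => EuclideanSpace ℝ (Fin 4)

theorem Real.rpow_le_rpow_self_mul_exp {u q : ℝ} (hu : 0 ≤ u) (hq : 0 < q) :
    u ^ q ≤ q ^ q * Real.exp u := by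
  have h : u ≤ q * Real.exp (u / q) := by
    have h1 := Real.add_one_le_exp (u / q)
    calc u = q * (u / q) := by field_simp
      _ ≤ q * Real.exp (u / q) := by gcongr; linarith
  calc u ^ q ≤ (q * Real.exp (u / q)) ^ q := by gcongr
    _ = q ^ q * Real.exp u := by
      rw [Real.mul_rpow hq.le (Real.exp_pos _).le, ← Real.exp_mul, div_mul_cancel₀ _ hq.ne']

theorem Real.exp_abs_log_le_add_inv {r : ℝ} (hr : 0 < r) :
    Real.exp |Real.log r| ≤ r + r⁻¹ := by
  have hr' : 0 < r⁻¹ := inv_pos.2 hr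
  rcases abs_choice (Real.log r) with h | h <;> rw [h]
  · rw [Real.exp_log hr]; linarith
  · rw [Real.exp_neg, Real.exp_log hr]; linarith

theorem Real.one_add_abs_log_rpow_le {r q : ℝ} (hr : 0 < r) (hq : 0 < q) :
    (1 + |Real.log r|) ^ q ≤ q ^ q * Real.exp 1 * (r + r⁻¹) :=
  calc (1 + |Real.log r|) ^ q ≤ q ^ q * Real.exp (1 + |Real.log r|) :=
        Real.rpow_le_rpow_self_mul_exp (by positivity) hq
    _ = q ^ q * Real.exp 1 * Real.exp |Real.log r| := by rw [Real.exp_add]; ring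
    _ ≤ q ^ q * Real.exp 1 * (r + r⁻¹) := by
      gcongr
      exact Real.exp_abs_log_le_add_inv hr

theorem integrable_indicator_norm_add_inv {V : Type*} [NormedAddCommGroup V] [NormedSpace ℝ V]
    [FiniteDimensional ℝ V] [MeasurableSpace V] [BorelSpace V] (μ : Measure V) [μ.IsAddHaarMeasure]
    (hV : 2 ≤ Module.finrank ℝ V) (R : ℝ) :
    Integrable (fun z : V => (Set.Iio R).indicator (fun r : ℝ => r + r⁻¹) ‖z‖) μ := by
  have : Nontrivial V := Module.nontrivial_of_finrank_pos (R := ℝ) (by omega)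
  rw [integrable_fun_norm_addHaar μ (f := (Set.Iio R).indicator fun r : ℝ => r + r⁻¹)]
  obtain ⟨n, hn⟩ := Nat.exists_eq_add_of_le' hV
  have hcont : IntegrableOn (fun r : ℝ => r ^ (n + 2) + r ^ n) (Set.Iio R ∩ Set.Ioi 0) :=
    ((by fun_prop : Continuous fun r : ℝ => r ^ (n + 2) + r ^ n).integrableOn_Icc
      (a := 0) (b := R)).mono_set fun r hr => ⟨hr.2.le, hr.1.le⟩
  refine ((integrableOn_indicator_iff measurableSet_Iio).2 hcont).congr_fun ?_ measurableSet_Ioi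
  intro r hr
  have hr0 : r ≠ 0 := (Set.mem_Ioi.1 hr).ne'
  by_cases hrR : r ∈ Set.Iio R
  · simp only [Set.indicator_of_mem hrR, hn, smul_eq_mul, Nat.add_succ_sub_one]
    field_simp
    ring
  · simp [Set.indicator_of_notMem hrR]

/-- If `|G(x,y)| ≤ C(1 + |log|x-y||)` on a bounded set `Ω ⊆ ℝ⁴`, then there is `C' > 0`
such that `∫_Ω |G(x,y)|^{p+1} dy ≤ C'^{p+1}(p+1)^{p+2}` for all `x ∈ Ω` and `p ≥ 1`. -/
theorem green_Lp_estimate (Ω : Set E) (hΩmeas : MeasurableSet Ω)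
    (hΩbdd : Bornology.IsBounded Ω)
    (G : E → E → ℝ) (hGmeas : ∀ x, Measurable (G x)) (C : ℝ) (hC : 0 < C)
    (hG : ∀ x ∈ Ω, ∀ y ∈ Ω, x ≠ y → |G x y| ≤ C * (1 + |Real.log ‖x - y‖|)) :
    ∃ C' > (0 : ℝ), ∀ x ∈ Ω, ∀ p : ℝ, 1 ≤ p →
      (∫ y in Ω, |G x y| ^ (p + 1)) ≤ C' ^ (p + 1) * (p + 1) ^ (p + 2) := by
  set h : E → ℝ := fun z =>
    (Set.Iio (Metric.diam Ω + 1)).indicator (fun r : ℝ => r + r⁻¹) ‖z‖ with hh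
  have h_integrable : Integrable h :=
    integrable_indicator_norm_add_inv volume (by simp) _
  have hnonneg : ∀ z, 0 ≤ h z := fun z =>
    Set.indicator_apply_nonneg fun _ => by positivity
  set K : ℝ := max 1 (Real.exp 1 * ∫ z, h z)
  have hK : 1 ≤ K := le_max_left _ _
  refine ⟨C * K, by positivity, fun x hx p hp => ?_⟩
  have hpt : ∀ y ∈ Ω, x ≠ y →
      |G x y| ^ (p + 1) ≤ C ^ (p + 1) * ((p + 1) ^ (p + 1) * Real.exp 1) * h (x - y) := by
    intro y hy hxy
    have hdist : ‖x - y‖ ∈ Set.Iio (Metric.diam Ω + 1) := by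
      have := Metric.dist_le_diam_of_mem hΩbdd hx hy
      rw [dist_eq_norm] at this
      exact this.trans_lt (lt_add_one _)
    calc |G x y| ^ (p + 1) ≤ (C * (1 + |Real.log ‖x - y‖|)) ^ (p + 1) := by
          gcongr
          exact hG x hx y hy hxy
      _ = C ^ (p + 1) * (1 + |Real.log ‖x - y‖|) ^ (p + 1) :=
          Real.mul_rpow hC.le (by positivity)
      _ ≤ C ^ (p + 1) * ((p + 1) ^ (p + 1) * Real.exp 1 * (‖x - y‖ + ‖x - y‖⁻¹)) := by
          gcongr
          exact Real.one_add_abs_log_rpow_le (norm_pos_iff.2 (sub_ne_zero.2 hxy)) (by linarith)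
      _ = C ^ (p + 1) * ((p + 1) ^ (p + 1) * Real.exp 1) * h (x - y) := by
          rw [hh]
          simp only [Set.indicator_of_mem hdist]
          ring
  have h_integrable_sub : Integrable fun y => h (x - y) := h_integrable.comp_sub_left x
  have hne : ∀ᵐ y ∂(volume : Measure E), x ≠ y := by
    filter_upwards [Measure.ae_ne volume x] with y hy using hy.symm
  calc ∫ y in Ω, |G x y| ^ (p + 1)
      ≤ ∫ y in Ω, C ^ (p + 1) * ((p + 1) ^ (p + 1) * Real.exp 1) * h (x - y) := by
        refine integral_mono_of_nonneg (ae_of_all _ fun y => by positivity)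
          (h_integrable_sub.const_mul _).integrableOn ?_
        filter_upwards [ae_restrict_mem hΩmeas, ae_restrict_of_ae hne] with y hy hxy
          using hpt y hy hxy
    _ = C ^ (p + 1) * ((p + 1) ^ (p + 1) * Real.exp 1) * ∫ y in Ω, h (x - y) :=
        integral_const_mul _ _
    _ ≤ C ^ (p + 1) * ((p + 1) ^ (p + 1) * Real.exp 1) * ∫ y, h (x - y) := by
        refine mul_le_mul_of_nonneg_left ?_ (by positivity)
        exact setIntegral_le_integral h_integrable_sub (ae_of_all _ fun y => hnonneg _)
    _ = C ^ (p + 1) * (p + 1) ^ (p + 1) * (Real.exp 1 * ∫ z, h z) := by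
        rw [integral_sub_left_eq_self h volume x]; ring
    _ ≤ C ^ (p + 1) * (p + 1) ^ (p + 1) * (K ^ (p + 1) * (p + 1)) := by
        refine mul_le_mul_of_nonneg_left ?_ (by positivity)
        calc Real.exp 1 * ∫ z, h z ≤ K := le_max_right _ _
          _ ≤ K ^ (p + 1) := Real.self_le_rpow_of_one_le hK (by linarith)
          _ ≤ K ^ (p + 1) * (p + 1) := le_mul_of_one_le_right (by positivity) (by linarith)
    _ = (C * K) ^ (p + 1) * (p + 1) ^ (p + 2) := by
        rw [Real.mul_rpow hC.le (by positivity), show p + 2 = (p + 1) + 1 by ring,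
          Real.rpow_add_one (x := p + 1) (by positivity) (p + 1)]
        ring
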